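/- arXiv:1704.06103 — 2 statements merged into one kernel-verified Lean document; each statement's English description precedes it below -/
import Mathlib

section
/- For all positive integers c, q and every Dirichlet character χ mod q: ∑_{a=1, (a(c−a), q)=1}^{q} χ(a) = μ(q*) χ*(c) (φ(q)/φ(q*)) ∏_{p|q, p∤q*c} (p−2)/(p−1), where χ* mod q* is the primitive character inducing χ, μ is the Möbius function and φ Euler's totient. -/
open Complex DirichletCharacter Finset

noncomputable section
open scoped Classical

lemma aux_moebius_sum (n : ℕ) (hn : n ≠ 0) :
    ∑ d ∈ n.divisors, (ArithmeticFunction.moebius d : ℂ) = if n = 1 then 1 else 0 := by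
  have h := congrArg (fun f : ArithmeticFunction ℤ => f n) ArithmeticFunction.moebius_mul_coe_zeta
  simp only [ArithmeticFunction.coe_mul_zeta_apply, ArithmeticFunction.one_apply] at h
  exact_mod_cast h

lemma aux_indicator (c q a : ℕ) (hq : 0 < q) :
    ∑ d ∈ q.divisors, (if (ZMod.cast (a : ZMod q) : ZMod d) = (c : ZMod d) then
      (ArithmeticFunction.moebius d : ℂ) else 0)
      = if Int.gcd ((c : ℤ) - a) q = 1 then 1 else 0 := by
  have hg : Int.gcd ((c : ℤ) - a) q ≠ 0 := by
    intro h
    rw [Int.gcd_eq_zero_iff] at h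
    have := h.2
    omega
  rw [← aux_moebius_sum _ hg, ← Finset.sum_filter]
  apply Finset.sum_congr _ (fun _ _ => rfl)
  ext d
  simp only [Finset.mem_filter, Nat.mem_divisors]
  constructor
  · rintro ⟨⟨hd, _⟩, h⟩
    refine ⟨?_, hg⟩
    rw [ZMod.cast_natCast hd, ← Int.cast_natCast a, ← Int.cast_natCast c,
      ZMod.intCast_eq_intCast_iff_dvd_sub] at h
    exact Int.dvd_gcd h (by exact_mod_cast hd)
  · rintro ⟨h, _⟩
    have h1 : (d : ℤ) ∣ (c : ℤ) - a := (Int.natCast_dvd_natCast.2 h).trans (Int.gcd_dvd_left ..)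
    have h2 : d ∣ q := by
      have : (d : ℤ) ∣ q := (Int.natCast_dvd_natCast.2 h).trans (Int.gcd_dvd_right ..)
      exact_mod_cast this
    refine ⟨⟨h2, hq.ne'⟩, ?_⟩
    rw [ZMod.cast_natCast h2, ← Int.cast_natCast a, ← Int.cast_natCast c,
      ZMod.intCast_eq_intCast_iff_dvd_sub]
    exact h1

lemma aux_step1_nat (c q : ℕ) [NeZero q] (χ : DirichletCharacter ℂ q) :
    ∑ a ∈ (Finset.Icc (1 : ℕ) q).filter
        (fun a : ℕ => Int.gcd ((a : ℤ) * ((c : ℤ) - (a : ℤ))) q = 1),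
      χ (a : ZMod q)
    = ∑ x : ZMod q, χ x * ∑ d ∈ q.divisors, (if (ZMod.cast x : ZMod d) = (c : ZMod d) then
      (ArithmeticFunction.moebius d : ℂ) else 0) := by
  have hq : 0 < q := Nat.pos_of_ne_zero (NeZero.ne q)
  rw [Finset.sum_filter]
  refine Finset.sum_bij (fun a _ => (a : ZMod q)) (fun _ _ => Finset.mem_univ _) ?_ ?_ ?_
  · intro a ha b hb h
    simp only [Finset.mem_Icc] at ha hb
    rw [ZMod.natCast_eq_natCast_iff] at h
    have h1 := (Nat.modEq_iff_dvd.1 h)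
    obtain ⟨k, hk⟩ := h1
    have : k = 0 := by
      have h1 : (q : ℤ) * k < q * 1 := by rw [← hk]; omega
      have h2 : (q : ℤ) * (-1) < q * k := by rw [← hk]; omega
      have hq' : (0 : ℤ) < q := by exact_mod_cast hq
      have := lt_of_mul_lt_mul_left h1 hq'.le
      have := lt_of_mul_lt_mul_left h2 hq'.le
      omega
    subst this
    omega
  · intro x _
    by_cases hx : x = 0
    · exact ⟨q, by simp; omega, by simp [hx]⟩
    · refine ⟨x.val, ?_, by simp⟩
      have := x.val_lt
      have : x.val ≠ 0 := by simpa using hx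
      simp; omega
  · intro a _
    rw [aux_indicator c q a hq]
    have hmul : Int.gcd ((a : ℤ) * ((c : ℤ) - (a : ℤ))) q = 1 ↔
        Int.gcd a q = 1 ∧ Int.gcd ((c : ℤ) - a) q = 1 := by
      simp only [← Int.isCoprime_iff_gcd_eq_one]
      exact IsCoprime.mul_left_iff
    by_cases h1 : Int.gcd a q = 1
    · by_cases h2 : Int.gcd ((c : ℤ) - a) q = 1
      · rw [if_pos (hmul.2 ⟨h1, h2⟩), if_pos h2, mul_one]
      · rw [if_neg (fun h => h2 (hmul.1 h).2), if_neg h2, mul_zero]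
    · rw [if_neg (fun h => h1 (hmul.1 h).1)]
      have : χ ((a : ℤ) : ZMod q) = 0 := by
        rw [DirichletCharacter.apply_eq_zero_iff, Int.isCoprime_iff_gcd_eq_one]
        exact h1
      rw [Int.cast_natCast] at this
      rw [this, zero_mul]

lemma aux_step1 (c q : ℕ) [NeZero q] (χ : DirichletCharacter ℂ q) :
    ∑ a ∈ (Finset.Icc 1 q).filter
        (fun a => Int.gcd ((a : ℤ) * ((c : ℤ) - (a : ℤ))) q = 1),
      χ (a : ZMod q)
    = ∑ x : ZMod q, χ x * ∑ d ∈ q.divisors, (if (ZMod.cast x : ZMod d) = (c : ZMod d) then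
      (ArithmeticFunction.moebius d : ℂ) else 0) := by
  rw [← aux_step1_nat]
  symm
  refine Finset.sum_bij (fun a _ => (a : ℤ)) ?_ ?_ ?_ ?_
  · intro a ha
    simp only [Finset.mem_filter, Finset.bind_def, Finset.pure_def, Finset.mem_sup,
      Finset.mem_singleton] at ha ⊢
    exact ⟨⟨a, ha.1, rfl⟩, ha.2⟩
  · intro a _ b _ h
    exact_mod_cast h
  · intro b hb
    simp only [Finset.mem_filter, Finset.bind_def, Finset.pure_def, Finset.mem_sup,
      Finset.mem_singleton] at hb
    obtain ⟨⟨a, ha, rfl⟩, hb⟩ := hb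
    exact ⟨a, Finset.mem_filter.2 ⟨ha, hb⟩, rfl⟩
  · intro a _
    rw [Int.cast_natCast]

lemma aux_T_units (c q d : ℕ) [NeZero q] (hd : d ∣ q) (χ : DirichletCharacter ℂ q) :
    ∑ x : ZMod q, (if (ZMod.cast x : ZMod d) = (c : ZMod d) then χ x else 0)
    = ∑ u : (ZMod q)ˣ, (if (ZMod.unitsMap hd u : ZMod d) = (c : ZMod d) then χ u else 0) := by
  symm
  refine Finset.sum_of_injOn (fun u : (ZMod q)ˣ => (u : ZMod q)) ?_ ?_ ?_ ?_
  · intro a _ b _ h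
    exact Units.ext h
  · intro a _; simp
  · intro x _ hx
    have : χ x = 0 := by
      apply χ.map_nonunit
      rintro ⟨u, rfl⟩
      exact hx ⟨u, by simp, rfl⟩
    simp [this]
  · intro u _
    rw [ZMod.unitsMap_val]

lemma aux_T (c q d : ℕ) [NeZero q] (hd : d ∣ q) (χ : DirichletCharacter ℂ q) :
    ∑ x : ZMod q, (if (ZMod.cast x : ZMod d) = (c : ZMod d) then χ x else 0)
    = if χ.conductor ∣ d ∧ Nat.Coprime c d then
        χ.primitiveCharacter (c : ZMod χ.conductor) * ((q.totient : ℂ) / d.totient) else 0 := by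
  rw [aux_T_units c q d hd χ]
  have : NeZero d := ⟨by rintro rfl; exact NeZero.ne q (by simpa using hd)⟩
  by_cases hcop : Nat.Coprime c d
  swap
  · rw [if_neg (fun h => hcop h.2)]
    apply Finset.sum_eq_zero
    intro u _
    rw [if_neg]
    intro h
    apply hcop
    rw [← ZMod.isUnit_iff_coprime, ← h]
    exact Units.isUnit _
  obtain ⟨v, hv⟩ := (ZMod.isUnit_iff_coprime c d).2 hcop
  rw [← hv]
  simp only [Units.val_inj]
  by_cases hN : χ.conductor ∣ d
  swap
  · rw [if_neg (fun h => hN h.1)]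
    have hF : ¬ χ.FactorsThrough d := fun h =>
      hN (χ.conductor_dvd_of_mem_conductorSet h)
    rw [factorsThrough_iff_ker_unitsMap hd, SetLike.not_le_iff_exists] at hF
    obtain ⟨w, hw, hw'⟩ := hF
    rw [MonoidHom.mem_ker] at hw hw'
    have hw1 : χ (w : ZMod q) ≠ 1 := by
      intro h
      apply hw'
      ext
      rw [MulChar.coe_toUnitHom, h, Units.val_one]
    set S := ∑ u : (ZMod q)ˣ, (if ZMod.unitsMap hd u = v then χ u else 0) with hS
    have : S = χ w * S := by
      conv_lhs => rw [hS, ← Equiv.sum_comp (Equiv.mulLeft w)]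
      rw [hS, Finset.mul_sum]
      apply Finset.sum_congr rfl
      intro u _
      simp only [Equiv.coe_mulLeft, map_mul, hw, one_mul, Units.val_mul, mul_ite, mul_zero]
    have h0 : (χ w - 1) * S = 0 := by linear_combination -this
    rcases mul_eq_zero.1 h0 with h | h
    · exact absurd (sub_eq_zero.1 h) hw1
    · exact h
  · rw [if_pos ⟨hN, hcop⟩]
    have hval : ∀ u : (ZMod q)ˣ, ZMod.unitsMap hd u = v →
        χ u = χ.primitiveCharacter (c : ZMod χ.conductor) := by
      intro u hu
      conv_lhs => rw [← χ.changeLevel_primitiveCharacter]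
      rw [changeLevel_eq_cast_of_dvd]
      congr 1
      have h1 : (ZMod.cast (u : ZMod q) : ZMod d) = c := by
        rw [← hv, ← hu, ZMod.unitsMap_val]
      have h2 := congrArg (ZMod.castHom hN (ZMod χ.conductor)) h1
      rw [map_natCast] at h2
      rw [← h2]
      have := ZMod.castHom_comp hN hd
      exact (congrArg (fun f => f (u : ZMod q)) this).symm
    have hcard : ((#{u : (ZMod q)ˣ | ZMod.unitsMap hd u = v} : ℕ) : ℂ)
        = (q.totient : ℂ) / d.totient := by
      have hs := ZMod.unitsMap_surjective hd
      have h1 : q.totient = d.totient * #{u : (ZMod q)ˣ | ZMod.unitsMap hd u = v} := by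
        rw [← ZMod.card_units_eq_totient q, ← ZMod.card_units_eq_totient d,
          ← Finset.card_univ, Finset.card_eq_sum_card_fiberwise
            (f := ZMod.unitsMap hd) (t := Finset.univ) (by simp)]
        rw [Finset.sum_congr rfl (fun y _ =>
          MonoidHom.card_fiber_eq_of_mem_range (ZMod.unitsMap hd) (hs y) (hs v))]
        simp
      have h2 : (d.totient : ℂ) ≠ 0 := by
        have := Nat.totient_pos.2 (Nat.pos_of_ne_zero (NeZero.ne d))
        exact_mod_cast this.ne'
      rw [h1]
      push_cast
      field_simp
    rw [← hcard, ← Finset.sum_filter,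
      Finset.sum_congr rfl (fun u hu => hval u (Finset.mem_filter.1 hu).2)]
    simp [mul_comm]

lemma aux_comb (c q N : ℕ) (hq : 0 < q) (hN : N ∣ q) (hc : Nat.Coprime c N) :
    ∑ d ∈ q.divisors, (if N ∣ d ∧ Nat.Coprime c d then
      (ArithmeticFunction.moebius d : ℂ) / d.totient else 0)
    = (ArithmeticFunction.moebius N : ℂ) / N.totient *
      ∏ p ∈ q.primeFactors.filter (fun p => ¬ p ∣ N * c), (((p : ℂ) - 2) / ((p : ℂ) - 1)) := by
  by_cases hsq : Squarefree N
  swap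
  · rw [ArithmeticFunction.moebius_eq_zero_of_not_squarefree hsq]
    simp only [Int.cast_zero, zero_div, zero_mul]
    apply Finset.sum_eq_zero
    intro d _
    split_ifs with h
    · rw [ArithmeticFunction.moebius_eq_zero_of_not_squarefree
        (fun hs => hsq (hs.squarefree_of_dvd h.1))]
      simp
    · rfl
  set P := q.primeFactors.filter (fun p => ¬ p ∣ N * c) with hP
  have hPp : ∀ p ∈ P, p.Prime := fun p hp => Nat.prime_of_mem_primeFactors (Finset.mem_filter.1 hp).1
  have hPN : ∀ p ∈ P, Nat.Coprime N p ∧ Nat.Coprime c p := by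
    intro p hp
    have h := (Finset.mem_filter.1 hp).2
    refine ⟨((hPp p hp).coprime_iff_not_dvd.2 fun h' => h (h'.mul_right _)).symm,
      ((hPp p hp).coprime_iff_not_dvd.2 fun h' => h (h'.mul_left _)).symm⟩
  have hprod : ∏ p ∈ P, (((p : ℂ) - 2) / ((p : ℂ) - 1))
      = ∏ p ∈ P, (1 + (-1) / ((p : ℂ) - 1)) := by
    apply Finset.prod_congr rfl
    intro p hp
    have : (p : ℂ) - 1 ≠ 0 := by
      rw [sub_ne_zero]
      exact_mod_cast (hPp p hp).one_lt.ne'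
    field_simp
    ring
  rw [hprod, Finset.prod_one_add, Finset.mul_sum]
  symm
  refine Finset.sum_of_injOn (fun s => N * ∏ p ∈ s, p) ?_ ?_ ?_ ?_
  · intro s hs t ht h
    simp only [Finset.coe_powerset, Set.mem_preimage, Set.mem_powerset_iff,
      Finset.coe_subset] at hs ht
    have h' := Nat.eq_of_mul_eq_mul_left (Nat.pos_of_dvd_of_pos hN hq) h
    rw [← Nat.primeFactors_prod (fun p hp => hPp p (hs hp)), h',
      Nat.primeFactors_prod (fun p hp => hPp p (ht hp))]
  · intro s hs
    simp only [Finset.coe_powerset, Set.mem_preimage, Set.mem_powerset_iff,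
      Finset.coe_subset] at hs
    simp only [Finset.mem_coe, Nat.mem_divisors]
    refine ⟨?_, hq.ne'⟩
    apply Nat.Coprime.mul_dvd_of_dvd_of_dvd _ hN
    · apply Finset.prod_primes_dvd
      · exact fun p hp => (hPp p (hs hp)).prime
      · exact fun p hp => Nat.dvd_of_mem_primeFactors (Finset.mem_filter.1 (hs hp)).1
    · exact Nat.Coprime.prod_right fun p hp => (hPN p (hs hp)).1
  · intro d hd hd'
    split_ifs with h
    swap
    · rfl
    obtain ⟨⟨e, rfl⟩, hcd⟩ := h
    by_cases hds : Squarefree (N * e)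
    swap
    · rw [ArithmeticFunction.moebius_eq_zero_of_not_squarefree hds]
      simp
    exfalso
    apply hd'
    obtain ⟨h1, h2, h3⟩ := Nat.squarefree_mul_iff.1 hds
    refine ⟨e.primeFactors, ?_, by simp only [Nat.prod_primeFactors_of_squarefree h3]⟩
    simp only [Finset.coe_powerset, Set.mem_preimage, Set.mem_powerset_iff, Finset.coe_subset]
    intro p hp
    have hpp := Nat.prime_of_mem_primeFactors hp
    have hpe := Nat.dvd_of_mem_primeFactors hp
    rw [hP, Finset.mem_filter, Nat.mem_primeFactors]
    refine ⟨⟨hpp, (hpe.mul_left _).trans (Nat.dvd_of_mem_divisors hd), hq.ne'⟩, ?_⟩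
    rw [hpp.dvd_mul]
    rintro (h | h)
    · exact Nat.not_coprime_of_dvd_of_dvd hpp.one_lt h hpe h1
    · exact Nat.not_coprime_of_dvd_of_dvd hpp.one_lt h (hpe.mul_left _) hcd
  · intro s hs
    rw [Finset.mem_powerset] at hs
    have hcopN : Nat.Coprime N (∏ p ∈ s, p) :=
      Nat.Coprime.prod_right fun p hp => (hPN p (hs hp)).1
    rw [if_pos ⟨dvd_mul_right _ _,
      hc.mul_right (Nat.Coprime.prod_right fun p hp => (hPN p (hs hp)).2)⟩]
    have key : ∏ p ∈ s, ((-1) / ((p : ℂ) - 1))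
        = (ArithmeticFunction.moebius (∏ p ∈ s, p) : ℂ) / (∏ p ∈ s, p).totient := by
      clear hcopN
      induction s using Finset.induction_on with
      | empty => simp
      | insert p s hps ih =>
        have hp := hPp p (hs (Finset.mem_insert_self _ _))
        have hs' : s ⊆ P := fun x hx => hs (Finset.mem_insert_of_mem hx)
        have hcp : Nat.Coprime p (∏ p ∈ s, p) := by
          apply Nat.Coprime.prod_right
          intro r hr
          exact (Nat.coprime_primes hp (hPp r (hs' hr))).2 (fun h => hps (h ▸ hr))
        rw [Finset.prod_insert hps, Finset.prod_insert hps, ih hs',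
          ArithmeticFunction.isMultiplicative_moebius.map_mul_of_coprime hcp,
          Nat.totient_mul hcp, ArithmeticFunction.moebius_apply_prime hp,
          Nat.totient_prime hp]
        push_cast [Nat.cast_sub hp.one_lt.le]
        rw [div_mul_div_comm]
    rw [key, ArithmeticFunction.isMultiplicative_moebius.map_mul_of_coprime hcopN,
      Nat.totient_mul hcopN, div_mul_div_comm]
    push_cast
    rfl

/-- For positive integers `c, q` and a Dirichlet character `χ mod q`,
`∑_{a=1, (a(c−a), q)=1}^{q} χ(a) = μ(q*) χ*(c) (φ(q)/φ(q*)) ∏_{p ∣ q, p ∤ q*c} (p−2)/(p−1)`,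
where `χ* mod q*` is the primitive character inducing `χ`. -/
theorem statement_17 (c q : ℕ) (hc : 0 < c) (hq : 0 < q) (χ : DirichletCharacter ℂ q) :
    ∑ a ∈ (Finset.Icc 1 q).filter
        (fun a => Int.gcd ((a : ℤ) * ((c : ℤ) - (a : ℤ))) q = 1),
      χ (a : ZMod q)
    = (ArithmeticFunction.moebius χ.conductor : ℂ) *
        χ.primitiveCharacter (c : ZMod χ.conductor) *
        ((q.totient : ℂ) / (χ.conductor.totient : ℂ)) *
        ∏ p ∈ q.primeFactors.filter (fun p => ¬ p ∣ χ.conductor * c),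
          (((p : ℂ) - 2) / ((p : ℂ) - 1)) := by
  have : NeZero q := ⟨hq.ne'⟩
  rw [aux_step1]
  have h1 : ∑ x : ZMod q, χ x * ∑ d ∈ q.divisors,
      (if (ZMod.cast x : ZMod d) = (c : ZMod d) then
        (ArithmeticFunction.moebius d : ℂ) else 0)
      = ∑ d ∈ q.divisors, (ArithmeticFunction.moebius d : ℂ) *
        ∑ x : ZMod q, (if (ZMod.cast x : ZMod d) = (c : ZMod d) then χ x else 0) := by
    simp only [Finset.mul_sum]
    rw [Finset.sum_comm]
    refine Finset.sum_congr rfl fun d _ => Finset.sum_congr rfl fun x _ => ?_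
    split_ifs <;> ring
  rw [h1, Finset.sum_congr rfl (fun d hd => by
    rw [aux_T c q d (Nat.dvd_of_mem_divisors hd) χ])]
  by_cases hcN : Nat.Coprime c χ.conductor
  · have h2 := aux_comb c q χ.conductor hq χ.conductor_dvd_level hcN
    calc _ = χ.primitiveCharacter (c : ZMod χ.conductor) * (q.totient : ℂ) *
          ∑ d ∈ q.divisors, (if χ.conductor ∣ d ∧ Nat.Coprime c d then
            (ArithmeticFunction.moebius d : ℂ) / d.totient else 0) := by
            rw [Finset.mul_sum]
            refine Finset.sum_congr rfl fun d _ => ?_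
            split_ifs <;> ring
      _ = _ := by rw [h2]; ring
  · have h0 : χ.primitiveCharacter (c : ZMod χ.conductor) = 0 := by
      apply MulChar.map_nonunit
      rwa [ZMod.isUnit_iff_coprime]
    simp [h0]
end
end

section
/- For all positive integers c, q and every x ≥ 2: ∑_{n≤x, n≡c (mod q)} J(n) = (𝔖_q(c)/2) x² + O(x log x), where the implied constant is absolute. -/
open Complex Finset

noncomputable section
open scoped Classical

/-- The twin prime constant `C₂ = 2 ∏_{p > 2} (1 - 1/(p-1)²)`. -/
def twinC : ℝ := 2 * ∏' p : {p : ℕ // p.Prime ∧ 2 < p}, (1 - 1 / ((p : ℝ) - 1) ^ 2)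

/-- The Hardy–Littlewood prediction `J(n)`: `0` for odd `n`, and
`C₂ n ∏_{p ∣ n, p > 2} (p-1)/(p-2)` for even `n`. -/
def Jfun (n : ℕ) : ℝ :=
  if 2 ∣ n then
    twinC * n * ∏ p ∈ n.primeFactors.filter (fun p => 2 < p), ((p : ℝ) - 1) / ((p : ℝ) - 2)
  else 0

/-- The singular series `𝔖_q(c) = φ(q)⁻¹ ∏_{p ∣ q, p ∤ c} (p-2)/(p-1)`. -/
def singSeries (q c : ℕ) : ℝ :=
  (1 / (q.totient : ℝ)) *
    ∏ p ∈ q.primeFactors.filter (fun p => ¬ p ∣ c), ((p : ℝ) - 2) / ((p : ℝ) - 1)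

/-- Multiplicative function supported on squarefree numbers with prescribed values at primes. -/
def sqfF (a : ℕ → ℝ) (d : ℕ) : ℝ := if Squarefree d then ∏ p ∈ d.primeFactors, a p else 0

theorem sqfF_nonneg (a : ℕ → ℝ) (ha : ∀ p, p.Prime → 0 ≤ a p) (d : ℕ) : 0 ≤ sqfF a d := by
  unfold sqfF
  split_ifs
  · exact Finset.prod_nonneg fun p hp => ha p (Nat.prime_of_mem_primeFactors hp)
  · exact le_rfl

theorem sqfF_zero (a : ℕ → ℝ) : sqfF a 0 = 0 := by
  simp [sqfF]

theorem sqfF_one (a : ℕ → ℝ) : sqfF a 1 = 1 := by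
  simp [sqfF]

theorem sqfF_mul (a : ℕ → ℝ) {m n : ℕ} (h : Nat.Coprime m n) :
    sqfF a (m * n) = sqfF a m * sqfF a n := by
  unfold sqfF
  rw [h.primeFactors_mul, Finset.prod_union h.disjoint_primeFactors]
  simp only [Nat.squarefree_mul h]
  by_cases h1 : Squarefree m <;> by_cases h2 : Squarefree n <;> simp [h1, h2]

theorem sqfF_sum_divisors (a : ℕ → ℝ) {n : ℕ} (hn : n ≠ 0) :
    ∑ d ∈ n.divisors, sqfF a d = ∏ p ∈ n.primeFactors, (1 + a p) := by
  unfold sqfF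
  rw [Finset.prod_one_add, ← Finset.sum_filter]
  refine Finset.sum_bij' (fun d _ => d.primeFactors) (fun s _ => ∏ p ∈ s, p) ?_ ?_ ?_ ?_ ?_
  · intro d hd
    simp only [Finset.mem_filter, Nat.mem_divisors] at hd
    exact Finset.mem_powerset.2 (Nat.primeFactors_mono hd.1.1 hn)
  · intro s hs
    have hs' := Finset.mem_powerset.1 hs
    have hp : ∀ p ∈ s, p.Prime := fun p hp => Nat.prime_of_mem_primeFactors (hs' hp)
    simp only [Finset.mem_filter, Nat.mem_divisors]
    refine ⟨⟨(Finset.prod_dvd_prod_of_subset _ _ _ hs').trans (Nat.prod_primeFactors_dvd n), hn⟩, ?_⟩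
    refine Finset.squarefree_prod_of_pairwise_isCoprime ?_ ?_
    · intro p h1 q h2 h3
      exact Nat.coprime_iff_isRelPrime.1 ((Nat.coprime_primes (hp p h1) (hp q h2)).2 h3)
    · intro p h1
      exact (hp p h1).prime.squarefree
  · intro d hd
    simp only [Finset.mem_filter, Nat.mem_divisors] at hd
    exact Nat.prod_primeFactors_of_squarefree hd.2
  · intro s hs
    have hs' := Finset.mem_powerset.1 hs
    exact Nat.primeFactors_prod fun p hp => Nat.prime_of_mem_primeFactors (hs' hp)
  · intro d hd
    rfl

theorem sqfF_summable (a : ℕ → ℝ) (ha : ∀ p, p.Prime → 0 ≤ a p)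
    (ha' : ∀ p, p.Prime → a p ≤ 6 * (1 / (p : ℝ) ^ 2)) : Summable (sqfF a) := by
  have hs : Summable (fun n : ℕ => 6 * (1 / (n : ℝ) ^ 2)) :=
    (Real.summable_one_div_nat_pow.2 (by norm_num)).mul_left 6
  refine summable_of_sum_range_le (c := Real.exp (∑' n : ℕ, 6 * (1 / (n : ℝ) ^ 2)))
    (sqfF_nonneg a ha) fun n => ?_
  have hP : ∀ p ∈ Nat.primesBelow n, p.Prime := fun p hp => Nat.prime_of_mem_primesBelow hp
  set P := ∏ p ∈ Nat.primesBelow n, p with hPdef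
  have hP0 : P ≠ 0 := Finset.prod_ne_zero_iff.2 fun p hp => (hP p hp).ne_zero
  calc ∑ d ∈ Finset.range n, sqfF a d
      = ∑ d ∈ (Finset.range n).filter Squarefree, sqfF a d := by
        rw [Finset.sum_filter]
        refine Finset.sum_congr rfl fun d _ => ?_
        unfold sqfF
        split_ifs <;> rfl
    _ ≤ ∑ d ∈ P.divisors, sqfF a d := by
        refine Finset.sum_le_sum_of_subset_of_nonneg ?_ fun d _ _ => sqfF_nonneg a ha d
        intro d hd
        simp only [Finset.mem_filter, Finset.mem_range] at hd
        refine Nat.mem_divisors.2 ⟨?_, hP0⟩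
        rw [← Nat.prod_primeFactors_of_squarefree hd.2]
        refine Finset.prod_dvd_prod_of_subset _ _ _ fun p hp => ?_
        refine Nat.mem_primesBelow.2 ⟨?_, Nat.prime_of_mem_primeFactors hp⟩
        exact (Nat.le_of_mem_primeFactors hp).trans_lt hd.1
    _ = ∏ p ∈ Nat.primesBelow n, (1 + a p) := by
        rw [sqfF_sum_divisors a hP0, hPdef, Nat.primeFactors_prod hP]
    _ ≤ Real.exp (∑ p ∈ Nat.primesBelow n, a p) := by
        rw [Real.exp_sum]
        refine Finset.prod_le_prod (fun p hp => by linarith [ha p (hP p hp)]) fun p hp => ?_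
        linarith [Real.add_one_le_exp (a p)]
    _ ≤ _ := by
        refine Real.exp_le_exp.2 ?_
        refine (Finset.sum_le_sum fun p hp => ha' p (hP p hp)).trans ?_
        exact hs.sum_le_tsum _ fun i _ => by positivity

theorem sqfF_hasProd (a : ℕ → ℝ) (hs : Summable (sqfF a)) :
    HasProd (fun p : Nat.Primes => 1 + a p) (∑' d, sqfF a d) := by
  have := EulerProduct.eulerProduct_hasProd (f := sqfF a) (sqfF_one a) (fun h => sqfF_mul a h)
    hs.norm (sqfF_zero a)
  suffices h : (fun p : Nat.Primes => 1 + a p) = fun p : Nat.Primes => ∑' e, sqfF a (p ^ e) by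
    rw [h]
    exact this
  funext p
  have hp : (p : ℕ).Prime := p.2
  rw [tsum_eq_sum (s := Finset.range 2)]
  · simp [Finset.sum_range_succ, sqfF, hp.prime.squarefree, hp.primeFactors]
  · intro e he
    simp only [Finset.mem_range, not_lt] at he
    unfold sqfF
    rw [if_neg]
    intro h
    have := Nat.squarefree_pow_iff hp.ne_one (by omega : e ≠ 0) |>.1 h
    omega

/-- The `h` function. -/
def hF : ℕ → ℝ := sqfF fun p => 1 / ((p : ℝ) - 2)
/-- The `k` function. -/
def kF : ℕ → ℝ := sqfF fun p => 2 / ((p : ℝ) - 2)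

theorem prime_cast_two_le {p : ℕ} (hp : p.Prime) : (0 : ℝ) ≤ (p : ℝ) - 2 := by
  have : (2 : ℝ) ≤ p := by exact_mod_cast hp.two_le
  linarith

theorem hF_nonneg (d : ℕ) : 0 ≤ hF d :=
  sqfF_nonneg _ (fun p hp => div_nonneg (by norm_num) (prime_cast_two_le hp)) d

theorem kF_nonneg (d : ℕ) : 0 ≤ kF d :=
  sqfF_nonneg _ (fun p hp => div_nonneg (by norm_num) (prime_cast_two_le hp)) d

theorem sqfF_div (a : ℕ → ℝ) (d : ℕ) : sqfF a d / d = sqfF (fun p => a p / p) d := by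
  unfold sqfF
  split_ifs with h
  · rw [Finset.prod_div_distrib]
    congr 1
    conv_lhs => rw [← Nat.prod_primeFactors_of_squarefree h]
    push_cast
    rfl
  · simp

theorem aux_summable (a : ℝ) (h0 : 0 ≤ a) (h2 : a ≤ 2) :
    Summable (fun d : ℕ => sqfF (fun p => a / ((p : ℝ) - 2)) d / d) := by
  simp_rw [sqfF_div]
  refine sqfF_summable _ (fun p hp => ?_) (fun p hp => ?_)
  · exact div_nonneg (div_nonneg h0 (prime_cast_two_le hp)) (Nat.cast_nonneg _)
  · rcases hp.two_le.eq_or_lt with h | h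
    · subst h
      norm_num
    · have h3 : (3 : ℝ) ≤ p := by exact_mod_cast h
      rw [div_div, mul_one_div, div_le_div_iff₀ (by nlinarith) (by positivity)]
      have : a * (p : ℝ) ^ 2 ≤ 2 * (p : ℝ) ^ 2 := by gcongr
      nlinarith

theorem hF_summable : Summable (fun d : ℕ => hF d / d) := aux_summable 1 (by norm_num) (by norm_num)
theorem kF_summable : Summable (fun d : ℕ => kF d / d) := aux_summable 2 (by norm_num) (by norm_num)

theorem hF_le {d : ℕ} (hd : d ≠ 0) : hF d ≤ (1 / (d : ℝ)) * ∑ e ∈ d.divisors, kF e := by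
  unfold kF
  rw [sqfF_sum_divisors _ hd]
  have hd' : (0 : ℝ) < d := by positivity
  rw [one_div_mul_eq_div, le_div_iff₀ hd']
  unfold hF sqfF
  split_ifs with h
  · have : (d : ℝ) = ∏ p ∈ d.primeFactors, (p : ℝ) := by
      conv_lhs => rw [← Nat.prod_primeFactors_of_squarefree h]
      push_cast
      rfl
    rw [this, ← Finset.prod_mul_distrib]
    refine Finset.prod_le_prod ?_ ?_
    · intro p hp
      have := prime_cast_two_le (Nat.prime_of_mem_primeFactors hp)
      positivity
    · intro p hp
      rcases (Nat.prime_of_mem_primeFactors hp).two_le.eq_or_lt with h | h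
      · subst h
        norm_num
      · have h3 : (3 : ℝ) ≤ p := by exact_mod_cast h
        have : (p : ℝ) - 2 ≠ 0 := by linarith
        apply le_of_eq
        field_simp
        ring
  · rw [zero_mul]
    refine Finset.prod_nonneg fun p hp => ?_
    have := prime_cast_two_le (Nat.prime_of_mem_primeFactors hp)
    positivity

theorem hF_even {d : ℕ} (hd : 2 ∣ d) : hF d = 0 := by
  unfold hF sqfF
  split_ifs with h
  · refine Finset.prod_eq_zero (i := 2) ?_ (by norm_num)
    exact Nat.mem_primeFactors.2 ⟨Nat.prime_two, hd, h.ne_zero⟩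
  · rfl

theorem Jfun_eq {n : ℕ} (hn : n ≠ 0) (h2 : 2 ∣ n) :
    Jfun n = twinC * n * ∑ d ∈ n.divisors, hF d := by
  unfold Jfun hF
  rw [if_pos h2, sqfF_sum_divisors _ hn, Finset.prod_filter]
  congr 1
  refine Finset.prod_congr rfl fun p hp => ?_
  rcases (Nat.prime_of_mem_primeFactors hp).two_le.eq_or_lt with h | h
  · subst h
    norm_num
  · have h3 : (3 : ℝ) ≤ p := by exact_mod_cast h
    have : (p : ℝ) - 2 ≠ 0 := by linarith
    rw [if_pos h]
    field_simp
    ring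

theorem sum_Ioc_dvd (w : ℕ → ℝ) (A B : ℕ) {e : ℕ} (he : 0 < e) :
    ∑ d ∈ (Finset.Ioc A B).filter (fun d => e ∣ d), w d
      = ∑ m ∈ Finset.Ioc (A / e) (B / e), w (e * m) := by
  symm
  refine Finset.sum_bij (fun m _ => e * m) ?_ ?_ ?_ ?_
  · intro m hm
    simp only [Finset.mem_Ioc, Finset.mem_filter] at hm ⊢
    refine ⟨⟨?_, ?_⟩, dvd_mul_right _ _⟩
    · rw [mul_comm]
      exact (Nat.div_lt_iff_lt_mul he).1 hm.1
    · rw [mul_comm]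
      exact (Nat.le_div_iff_mul_le he).1 hm.2
  · intro m _ m' _ h
    exact Nat.eq_of_mul_eq_mul_left he h
  · intro d hd
    simp only [Finset.mem_Ioc, Finset.mem_filter] at hd
    obtain ⟨⟨h1, h2⟩, m, rfl⟩ := hd
    refine ⟨m, ?_, rfl⟩
    rw [mul_comm] at h1 h2
    exact Finset.mem_Ioc.2 ⟨(Nat.div_lt_iff_lt_mul he).2 h1, (Nat.le_div_iff_mul_le he).2 h2⟩
  · intro m _
    rfl

theorem sum_divisors_swap (w : ℕ → ℝ) (g : ℕ → ℝ) (A B : ℕ) :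
    ∑ d ∈ Finset.Ioc A B, w d * ∑ e ∈ d.divisors, g e
      = ∑ e ∈ Finset.Ioc 0 B, g e * ∑ d ∈ (Finset.Ioc A B).filter (fun d => e ∣ d), w d := by
  have : ∀ d ∈ Finset.Ioc A B, w d * ∑ e ∈ d.divisors, g e
      = ∑ e ∈ Finset.Ioc 0 B, if e ∣ d then g e * w d else 0 := by
    intro d hd
    have hd := Finset.mem_Ioc.1 hd
    rw [← Finset.sum_filter, Finset.mul_sum]
    refine Finset.sum_congr ?_ fun e _ => mul_comm _ _
    ext e
    simp only [Nat.mem_divisors, Finset.mem_filter, Finset.mem_Ioc]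
    constructor
    · rintro ⟨h1, h2⟩
      exact ⟨⟨Nat.pos_of_dvd_of_pos h1 (by omega), (Nat.le_of_dvd (by omega) h1).trans hd.2⟩, h1⟩
    · rintro ⟨h1, h2⟩
      exact ⟨h2, by omega⟩
  rw [Finset.sum_congr rfl this, Finset.sum_comm]
  refine Finset.sum_congr rfl fun e _ => ?_
  rw [← Finset.sum_filter, Finset.mul_sum]

/-- The constant `∑ k(e)/e`. -/
def kK : ℝ := ∑' e : ℕ, kF e / e

theorem kK_nonneg : 0 ≤ kK := tsum_nonneg fun e => div_nonneg (kF_nonneg e) (Nat.cast_nonneg _)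

theorem kF_sum_le (s : Finset ℕ) : ∑ e ∈ s, kF e / e ≤ kK :=
  kF_summable.sum_le_tsum _ fun e _ => div_nonneg (kF_nonneg e) (Nat.cast_nonneg _)

theorem hF_sum_head (N : ℕ) : ∑ d ∈ Finset.Ioc 0 N, hF d ≤ kK * (1 + Real.log N) := by
  have hlog : 0 ≤ 1 + Real.log N := by
    have := Real.log_natCast_nonneg N
    linarith
  calc ∑ d ∈ Finset.Ioc 0 N, hF d
      ≤ ∑ d ∈ Finset.Ioc 0 N, (1 / (d : ℝ)) * ∑ e ∈ d.divisors, kF e :=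
        Finset.sum_le_sum fun d hd => hF_le (by have := Finset.mem_Ioc.1 hd; omega)
    _ = _ := sum_divisors_swap (fun d => 1 / (d : ℝ)) kF 0 N
    _ ≤ ∑ e ∈ Finset.Ioc 0 N, kF e / e * (1 + Real.log N) := by
        refine Finset.sum_le_sum fun e he => ?_
        have he := (Finset.mem_Ioc.1 he).1
        rw [sum_Ioc_dvd _ _ _ he, div_mul_eq_mul_div, mul_div_assoc]
        refine mul_le_mul_of_nonneg_left ?_ (kF_nonneg e)
        have : ∀ m ∈ Finset.Ioc (0 / e) (N / e), 1 / ((e * m : ℕ) : ℝ) = (m : ℝ)⁻¹ / e := by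
          intro m _
          push_cast
          rw [one_div, mul_inv, div_eq_mul_inv, mul_comm]
        rw [Finset.sum_congr rfl this, ← Finset.sum_div]
        refine div_le_div_of_nonneg_right ?_ (Nat.cast_nonneg _)
        refine le_trans ?_ (harmonic_le_one_add_log N)
        rw [harmonic_eq_sum_Icc]
        push_cast
        refine Finset.sum_le_sum_of_subset_of_nonneg ?_ fun i _ _ => by positivity
        intro m hm
        have hm := Finset.mem_Ioc.1 hm
        exact Finset.mem_Icc.2 ⟨(Nat.zero_le _).trans_lt hm.1, hm.2.trans (Nat.div_le_self _ _)⟩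
    _ = (∑ e ∈ Finset.Ioc 0 N, kF e / e) * (1 + Real.log N) := by rw [Finset.sum_mul]
    _ ≤ _ := mul_le_mul_of_nonneg_right (kF_sum_le _) hlog

theorem hF_sum_tail (N M : ℕ) :
    ∑ d ∈ Finset.Ioc N M, hF d / d ≤ kK * (2 / ((N : ℝ) + 1)) := by
  calc ∑ d ∈ Finset.Ioc N M, hF d / d
      ≤ ∑ d ∈ Finset.Ioc N M, ((d : ℝ) ^ 2)⁻¹ * ∑ e ∈ d.divisors, kF e := by
        refine Finset.sum_le_sum fun d hd => ?_
        have hd : d ≠ 0 := by have := Finset.mem_Ioc.1 hd; omega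
        have hd' : (0 : ℝ) < d := by positivity
        rw [div_le_iff₀ hd']
        refine (hF_le hd).trans (le_of_eq ?_)
        field_simp
    _ = _ := sum_divisors_swap (fun d => ((d : ℝ) ^ 2)⁻¹) kF N M
    _ ≤ ∑ e ∈ Finset.Ioc 0 M, kF e / e * (2 / ((N : ℝ) + 1)) := by
        refine Finset.sum_le_sum fun e he => ?_
        have he := (Finset.mem_Ioc.1 he).1
        have he' : (0 : ℝ) < e := by exact_mod_cast he
        rw [sum_Ioc_dvd _ _ _ he, div_mul_eq_mul_div, mul_div_assoc]
        refine mul_le_mul_of_nonneg_left ?_ (kF_nonneg e)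
        have : ∀ m ∈ Finset.Ioc (N / e) (M / e),
            (((e * m : ℕ) : ℝ) ^ 2)⁻¹ = ((e : ℝ) ^ 2)⁻¹ * ((m : ℝ) ^ 2)⁻¹ := by
          intro m _
          push_cast
          rw [mul_pow, mul_inv]
        rw [Finset.sum_congr rfl this, ← Finset.mul_sum]
        have h1 : ∑ m ∈ Finset.Ioc (N / e) (M / e), ((m : ℝ) ^ 2)⁻¹
            ≤ 2 / (((N / e : ℕ) : ℝ) + 1) := by
          have := sum_Ioo_inv_sq_le (α := ℝ) (N / e) (M / e + 1)
          refine le_trans (le_of_eq ?_) this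
          refine Finset.sum_congr ?_ fun _ _ => rfl
          ext m
          simp only [Finset.mem_Ioc, Finset.mem_Ioo]
          omega
        have h2 : (N : ℝ) + 1 ≤ e * (((N / e : ℕ) : ℝ) + 1) := by
          have := Nat.lt_mul_div_succ N he
          exact_mod_cast this
        calc ((e : ℝ) ^ 2)⁻¹ * ∑ m ∈ Finset.Ioc (N / e) (M / e), ((m : ℝ) ^ 2)⁻¹
            ≤ ((e : ℝ) ^ 2)⁻¹ * (2 / (((N / e : ℕ) : ℝ) + 1)) := by gcongr
          _ = 2 / (e * (((N / e : ℕ) : ℝ) + 1)) / e := by field_simp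
          _ ≤ 2 / ((N : ℝ) + 1) / e := by gcongr
    _ = (∑ e ∈ Finset.Ioc 0 M, kF e / e) * (2 / ((N : ℝ) + 1)) := by rw [Finset.sum_mul]
    _ ≤ _ := mul_le_mul_of_nonneg_right (kF_sum_le _) (by positivity)

theorem gauss_ap (a L : ℝ) (J : ℕ) :
    ∑ j ∈ Finset.range (J + 1), (a + L * j) = ((J : ℝ) + 1) * (2 * a + L * J) / 2 := by
  induction J with
  | zero => simp
  | succ J ih =>
    rw [Finset.sum_range_succ, ih]
    push_cast
    ring

theorem ap_sum_aux (a L : ℕ) (haL : a < L) (x : ℝ) (hx : 0 ≤ x) :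
    |(∑ n ∈ (Finset.Iic ⌊x⌋₊).filter (fun n => n ≡ a [MOD L]), (n : ℝ)) - x ^ 2 / (2 * L)|
      ≤ 3 * x := by
  have hL : (0 : ℝ) < L := by exact_mod_cast (by omega : 0 < L)
  have haL' : (a : ℝ) < L := by exact_mod_cast haL
  by_cases hax : a ≤ ⌊x⌋₊
  · set J := (⌊x⌋₊ - a) / L with hJ
    have hsum : ∑ n ∈ (Finset.Iic ⌊x⌋₊).filter (fun n => n ≡ a [MOD L]), (n : ℝ)
        = ∑ j ∈ Finset.range (J + 1), ((a : ℝ) + L * j) := by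
      symm
      refine Finset.sum_bij (fun j _ => a + L * j) ?_ ?_ ?_ ?_
      · intro j hj
        simp only [Finset.mem_range, Finset.mem_filter, Finset.mem_Iic] at hj ⊢
        have : j * L ≤ ⌊x⌋₊ - a := (Nat.le_div_iff_mul_le (by omega)).1 (by omega)
        rw [mul_comm] at this
        refine ⟨by omega, ?_⟩
        simp [Nat.ModEq]
      · intro j _ j' _ h
        have h' : L * j = L * j' := by simpa using h
        exact Nat.eq_of_mul_eq_mul_left (by omega) h'
      · intro n hn
        simp only [Finset.mem_filter, Finset.mem_Iic] at hn
        have hna : n % L = a := by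
          have := hn.2
          unfold Nat.ModEq at this
          rw [this, Nat.mod_eq_of_lt haL]
        have h3 := Nat.mod_add_div n L
        rw [hna] at h3
        refine ⟨n / L, ?_, h3⟩
        rw [Finset.mem_range, Nat.lt_succ_iff, hJ, Nat.le_div_iff_mul_le (by omega), mul_comm]
        omega
      · intro j _
        push_cast
        rfl
    rw [hsum, gauss_ap]
    have hJ1 : (a : ℝ) + L * J ≤ x := by
      have h1 : J * L ≤ ⌊x⌋₊ - a := Nat.div_mul_le_self _ _
      have h2 : a + L * J ≤ ⌊x⌋₊ := by rw [mul_comm] at h1; omega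
      have h3 : ((a + L * J : ℕ) : ℝ) ≤ x := (Nat.le_floor_iff hx).1 h2
      exact_mod_cast h3
    have hJ2 : x < (a : ℝ) + L * J + L := by
      have h1 := Nat.lt_mul_div_succ (⌊x⌋₊ - a) (show 0 < L by omega)
      have h2 : ⌊x⌋₊ < a + L * J + L := by
        rw [← hJ, Nat.mul_add, Nat.mul_one] at h1
        omega
      have h3 := (Nat.floor_lt hx).1 h2
      exact_mod_cast h3
    set y : ℝ := (a : ℝ) + L * J with hy
    have ha0 : (0 : ℝ) ≤ a := Nat.cast_nonneg _
    have hay : (a : ℝ) ≤ y := by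
      have : (0 : ℝ) ≤ L * J := by positivity
      linarith
    have hJy : (J : ℝ) = (y - a) / L := by
      rw [hy]
      field_simp
      ring
    have key : ((J : ℝ) + 1) * (2 * a + L * J) / 2 - x ^ 2 / (2 * L)
        = ((y ^ 2 - x ^ 2) - (a : ℝ) ^ 2 + L * (y + a)) / (2 * L) := by
      rw [hJy]
      field_simp
      ring
    rw [key, abs_le]
    constructor
    · rw [le_div_iff₀ (by positivity)]
      nlinarith
    · rw [div_le_iff₀ (by positivity)]
      nlinarith
  · have hempty : (Finset.Iic ⌊x⌋₊).filter (fun n => n ≡ a [MOD L]) = ∅ := by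
      refine Finset.filter_eq_empty_iff.2 fun n hn h => ?_
      have hn := Finset.mem_Iic.1 hn
      have := Nat.ModEq.eq_of_lt_of_lt h (by omega) haL
      omega
    have hxa : x < a := (Nat.floor_lt hx).1 (by omega)
    rw [hempty, Finset.sum_empty, zero_sub, abs_neg, abs_of_nonneg (by positivity),
      div_le_iff₀ (by positivity)]
    nlinarith

theorem ap_sum (c q m : ℕ) (hq : 0 < q) (hm : 0 < m) (hg : Nat.gcd m q ∣ c) (x : ℝ) (hx : 0 ≤ x) :
    |(∑ n ∈ (Finset.Iic ⌊x⌋₊).filter (fun n => n ≡ c [MOD q] ∧ m ∣ n), (n : ℝ))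
      - x ^ 2 / (2 * (Nat.lcm m q : ℕ))| ≤ 3 * x := by
  have h0 : 0 ≡ c [MOD Nat.gcd m q] := ((Nat.modEq_zero_iff_dvd).2 hg).symm
  obtain ⟨a, ha1, ha2⟩ := Nat.chineseRemainder' h0
  have hL : 0 < Nat.lcm m q := Nat.lcm_pos hm hq
  have := ap_sum_aux (a % Nat.lcm m q) (Nat.lcm m q) (Nat.mod_lt _ hL) x hx
  convert this using 4
  refine Finset.filter_congr fun n _ => ?_
  have hmod : n ≡ a % Nat.lcm m q [MOD Nat.lcm m q] ↔ n ≡ a [MOD Nat.lcm m q] := by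
    simp [Nat.ModEq]
  rw [hmod]
  constructor
  · rintro ⟨h1, h2⟩
    exact Nat.mod_lcm (((Nat.modEq_zero_iff_dvd).2 h2).trans ha1.symm) (h1.trans ha2.symm)
  · intro h
    exact ⟨(h.of_dvd (Nat.dvd_lcm_right m q)).trans ha2,
      (Nat.modEq_zero_iff_dvd).1 ((h.of_dvd (Nat.dvd_lcm_left m q)).trans ha1)⟩

theorem ap_sum_empty (c q m N : ℕ) (hg : ¬ Nat.gcd m q ∣ c) :
    (∑ n ∈ (Finset.Iic N).filter (fun n => n ≡ c [MOD q] ∧ m ∣ n), (n : ℝ)) = 0 := by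
  rw [Finset.filter_eq_empty_iff.2, Finset.sum_empty]
  rintro n _ ⟨h1, h2⟩
  refine hg ?_
  exact ((h1.of_dvd (Nat.gcd_dvd_right m q)).dvd_iff dvd_rfl).1 ((Nat.gcd_dvd_left m q).trans h2)

/-- The main-term summand. -/
def gG (q c d : ℕ) : ℝ := if Nat.gcd d q ∣ c then hF d / d * (Nat.gcd d q : ℕ) else 0

/-- Local values of the main-term summand. -/
def bB (q c p : ℕ) : ℝ :=
  if p ∣ q then (if p ∣ c then 1 / ((p : ℝ) - 2) else 0) else 1 / ((p : ℝ) - 2) / p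

theorem gG_eq (q c : ℕ) (hq : 0 < q) (d : ℕ) : gG q c d = sqfF (bB q c) d := by
  by_cases hd : Squarefree d
  swap
  · have : hF d = 0 := by unfold hF sqfF; rw [if_neg hd]
    unfold gG sqfF
    rw [if_neg hd, this]
    simp
  have hgs : Squarefree (Nat.gcd d q) := hd.squarefree_of_dvd (Nat.gcd_dvd_left d q)
  have hpf : (Nat.gcd d q).primeFactors = d.primeFactors.filter (fun p => p ∣ q) := by
    ext p
    simp only [Nat.mem_primeFactors, Finset.mem_filter, Nat.dvd_gcd_iff]
    have := hd.ne_zero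
    have := hgs.ne_zero
    tauto
  have hprod := Nat.prod_primeFactors_of_squarefree hgs
  unfold gG
  split_ifs with hg
  · unfold hF
    rw [sqfF_div]
    unfold sqfF
    rw [if_pos hd, if_pos hd]
    have h1 : ((Nat.gcd d q : ℕ) : ℝ) = ∏ p ∈ d.primeFactors, if p ∣ q then (p : ℝ) else 1 := by
      rw [← Finset.prod_filter, ← hpf]
      conv_lhs => rw [← hprod]
      push_cast
      rfl
    rw [h1, ← Finset.prod_mul_distrib]
    refine Finset.prod_congr rfl fun p hp => ?_
    have hp' := Nat.prime_of_mem_primeFactors hp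
    have hp0 : (p : ℝ) ≠ 0 := by exact_mod_cast hp'.ne_zero
    unfold bB
    by_cases hpq : p ∣ q
    · have hpc : p ∣ c := (Nat.dvd_gcd (Nat.dvd_of_mem_primeFactors hp) hpq).trans hg
      rw [if_pos hpq, if_pos hpq, if_pos hpc, div_mul_cancel₀ _ hp0]
    · rw [if_neg hpq, if_neg hpq, mul_one]
  · unfold sqfF
    rw [if_pos hd]
    have : ∃ p ∈ (Nat.gcd d q).primeFactors, ¬ p ∣ c := by
      by_contra! hcon
      refine hg ?_
      rw [← hprod]
      exact Finset.prod_primes_dvd c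
        (fun p hp => (Nat.prime_of_mem_primeFactors hp).prime) hcon
    obtain ⟨p, hp, hpc⟩ := this
    rw [hpf, Finset.mem_filter] at hp
    refine (Finset.prod_eq_zero hp.1 ?_).symm
    unfold bB
    rw [if_pos hp.2, if_neg hpc]

theorem gG_nonneg (q c d : ℕ) : 0 ≤ gG q c d := by
  unfold gG
  have := hF_nonneg d
  split_ifs <;> positivity

theorem gG_le (q c : ℕ) (hq : 0 < q) (d : ℕ) : gG q c d ≤ hF d / d * q := by
  unfold gG
  have := hF_nonneg d
  split_ifs
  · have : Nat.gcd d q ≤ q := Nat.gcd_le_right _ hq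
    gcongr
  · positivity

theorem gG_summable (q c : ℕ) (hq : 0 < q) : Summable (gG q c) :=
  Summable.of_nonneg_of_le (gG_nonneg q c) (gG_le q c hq) (hF_summable.mul_right _)

theorem twin_hasProd : HasProd
    (Set.mulIndicator {p : ℕ | p.Prime ∧ 2 < p} fun p : ℕ => (1 - 1 / ((p : ℝ) - 1) ^ 2))
    (twinC / 2) := by
  have hs : Summable (fun p : ℕ => -(1 / ((p : ℝ) - 1) ^ 2)) := by
    refine Summable.neg ?_
    refine (summable_nat_add_iff 1).1 ?_
    simpa using (Real.summable_one_div_nat_pow (p := 2)).2 (by norm_num)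
  have hs' : Summable (fun p : {p : ℕ | p.Prime ∧ 2 < p} => -(1 / (((p : ℕ) : ℝ) - 1) ^ 2)) :=
    hs.comp_injective Subtype.val_injective
  have hm := multipliable_one_add_of_summable hs'.norm
  rw [← hasProd_subtype_iff_mulIndicator]
  have h := hm.hasProd
  have e : twinC / 2 = ∏' p : {p : ℕ | p.Prime ∧ 2 < p}, (1 + -(1 / (((p : ℕ) : ℝ) - 1) ^ 2)) := by
    unfold twinC
    rw [mul_div_cancel_left₀ _ (by norm_num)]
    simp only [sub_eq_add_neg]
    rfl
  rw [e]
  have e2 : (fun p : ℕ => (1 - 1 / ((p : ℝ) - 1) ^ 2)) ∘ ((↑) : {p : ℕ | p.Prime ∧ 2 < p} → ℕ)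
      = fun p : {p : ℕ | p.Prime ∧ 2 < p} => 1 + -(1 / (((p : ℕ) : ℝ) - 1) ^ 2) := by
    funext p
    simp only [Function.comp_apply, sub_eq_add_neg]
  rw [e2]
  exact h

theorem main_const (q c : ℕ) (hq : 0 < q) (h2 : Nat.gcd 2 q ∣ c) :
    singSeries q c = twinC * ((Nat.gcd 2 q : ℕ) / (2 * q)) * ∑' d, gG q c d := by
  have h1 : HasProd (Set.mulIndicator {p : ℕ | p.Prime} fun p => 1 + bB q c p)
      (∑' d, gG q c d) := by
    rw [← hasProd_subtype_iff_mulIndicator]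
    have hfun : gG q c = sqfF (bB q c) := funext (gG_eq q c hq)
    have hs := gG_summable q c hq
    rw [hfun] at hs ⊢
    exact sqfF_hasProd _ hs
  have h3 := twin_hasProd.mul h1
  have hp2 : ∀ p ∈ q.primeFactors, p ≠ 2 → (3 : ℝ) ≤ p := by
    intro p hp hne
    have := (Nat.prime_of_mem_primeFactors hp).two_le
    exact_mod_cast (by omega : 3 ≤ p)
  have h4 := hasProd_prod_of_ne_finset_one (L := SummationFilter.unconditional ℕ)
    (s := q.primeFactors) (f := fun p =>
      Set.mulIndicator {p : ℕ | p.Prime ∧ 2 < p} (fun p : ℕ => (1 - 1 / ((p : ℝ) - 1) ^ 2)) p *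
      Set.mulIndicator {p : ℕ | p.Prime} (fun p => 1 + bB q c p) p) (by
    intro p hp
    by_cases hpp : p.Prime
    · have hpq : ¬ p ∣ q := fun h => hp (Nat.mem_primeFactors.2 ⟨hpp, h, hq.ne'⟩)
      rw [Set.mulIndicator_of_mem (s := {p : ℕ | p.Prime}) hpp]
      unfold bB
      rw [if_neg hpq]
      by_cases h2p : 2 < p
      · rw [Set.mulIndicator_of_mem (show p ∈ {p : ℕ | p.Prime ∧ 2 < p} from ⟨hpp, h2p⟩)]
        have h3 : (3 : ℝ) ≤ p := by exact_mod_cast h2p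
        have e1 : (p : ℝ) - 1 ≠ 0 := by linarith
        have e2 : (p : ℝ) - 2 ≠ 0 := by linarith
        have e3 : (p : ℝ) ≠ 0 := by linarith
        field_simp
        ring
      · rw [Set.mulIndicator_of_notMem (fun h => h2p h.2)]
        have : p = 2 := by have := hpp.two_le; omega
        subst this
        norm_num
    · rw [Set.mulIndicator_of_notMem (fun h => hpp h.1), Set.mulIndicator_of_notMem (s := {p : ℕ | p.Prime}) hpp,
        mul_one])
  have h5 := h3.unique h4
  have hg2 : ((Nat.gcd 2 q : ℕ) : ℝ) = ∏ p ∈ q.primeFactors, if p = 2 then (2 : ℝ) else 1 := by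
    rw [Finset.prod_ite_eq']
    by_cases h : 2 ∣ q
    · rw [if_pos (Nat.mem_primeFactors.2 ⟨Nat.prime_two, h, hq.ne'⟩), Nat.gcd_eq_left h]
      norm_num
    · rw [if_neg (fun h' => h (Nat.dvd_of_mem_primeFactors h')),
        Nat.coprime_iff_gcd_eq_one.1 ((Nat.Prime.coprime_iff_not_dvd Nat.prime_two).2 h)]
      norm_num
  have htot : (q.totient : ℝ) * ∏ p ∈ q.primeFactors, (p : ℝ)
      = q * ∏ p ∈ q.primeFactors, ((p : ℝ) - 1) := by
    have := congrArg (Nat.cast : ℕ → ℝ) (Nat.totient_mul_prod_primeFactors q)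
    push_cast at this
    rw [this]
    congr 1
    refine Finset.prod_congr rfl fun p hp => ?_
    rw [Nat.cast_sub (Nat.prime_of_mem_primeFactors hp).one_lt.le]
    simp
  have hq0 : (q : ℝ) ≠ 0 := by exact_mod_cast hq.ne'
  have hφ0 : (q.totient : ℝ) ≠ 0 := by exact_mod_cast (Nat.totient_pos.2 hq).ne'
  have hP1 : ∏ p ∈ q.primeFactors, ((p : ℝ) - 1) ≠ 0 := by
    refine Finset.prod_ne_zero_iff.2 fun p hp => ?_
    have := prime_cast_two_le (Nat.prime_of_mem_primeFactors hp)
    linarith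
  have hφ : 1 / (q.totient : ℝ) = 1 / q * ∏ p ∈ q.primeFactors, ((p : ℝ) / ((p : ℝ) - 1)) := by
    rw [Finset.prod_div_distrib]
    field_simp
    linarith
  have e : twinC * ((Nat.gcd 2 q : ℕ) / (2 * q)) * ∑' d, gG q c d
      = 1 / q * ((Nat.gcd 2 q : ℕ) * (twinC / 2 * ∑' d, gG q c d)) := by
    field_simp
  rw [e, h5, hg2]
  unfold singSeries
  rw [hφ, mul_assoc, Finset.prod_filter, ← Finset.prod_mul_distrib, ← Finset.prod_mul_distrib]
  congr 1
  refine Finset.prod_congr rfl fun p hp => ?_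
  have hpp := Nat.prime_of_mem_primeFactors hp
  have hpq := Nat.dvd_of_mem_primeFactors hp
  rw [Set.mulIndicator_of_mem (s := {p : ℕ | p.Prime}) hpp]
  unfold bB
  rw [if_pos hpq]
  by_cases hp2' : p = 2
  · subst hp2'
    have hc : 2 ∣ c := by rwa [Nat.gcd_eq_left hpq] at h2
    rw [Set.mulIndicator_of_notMem (fun h => absurd h.2 (lt_irrefl _))]
    simp [hc]
    norm_num
  · have h3 := hp2 p hp hp2'
    have h2p : 2 < p := by exact_mod_cast (by linarith : (2 : ℝ) < p)
    rw [Set.mulIndicator_of_mem (show p ∈ {p : ℕ | p.Prime ∧ 2 < p} from ⟨hpp, h2p⟩), if_neg hp2']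
    have e1 : (p : ℝ) - 1 ≠ 0 := by linarith
    have e2 : (p : ℝ) - 2 ≠ 0 := by linarith
    have e3 : (p : ℝ) ≠ 0 := by linarith
    by_cases hpc : p ∣ c
    · simp only [hpc, if_true, not_true_eq_false, if_false]
      field_simp
      ring
    · simp only [hpc, if_false, not_false_eq_true, if_true]
      field_simp
      ring

theorem sum_J_eq (c q N : ℕ) :
    ∑ n ∈ (Finset.Iic N).filter (fun n => n ≡ c [MOD q]), Jfun n
      = twinC * ∑ d ∈ Finset.Ioc 0 N, hF d *
        ∑ n ∈ (Finset.Iic N).filter (fun n => n ≡ c [MOD q] ∧ 2 * d ∣ n), (n : ℝ) := by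
  have h1 : ∑ n ∈ (Finset.Iic N).filter (fun n => n ≡ c [MOD q]), Jfun n
      = ∑ n ∈ Finset.Ioc 0 N, (if n ≡ c [MOD q] ∧ 2 ∣ n then twinC * n else 0)
          * ∑ d ∈ n.divisors, hF d := by
    rw [Finset.sum_filter]
    symm
    have hsub : Finset.Ioc 0 N ⊆ Finset.Iic N := fun n hn =>
      Finset.mem_Iic.2 (Finset.mem_Ioc.1 hn).2
    have h0 : ∀ n ∈ Finset.Iic N, n ∉ Finset.Ioc 0 N →
        (if n ≡ c [MOD q] then Jfun n else 0) = 0 := by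
      intro n hn hn'
      have : n = 0 := by
        simp only [Finset.mem_Iic, Finset.mem_Ioc] at hn hn'
        omega
      subst this
      simp [Jfun]
    rw [← Finset.sum_subset hsub h0]
    refine Finset.sum_congr rfl fun n hn => ?_
    have hn0 : n ≠ 0 := by have := Finset.mem_Ioc.1 hn; omega
    by_cases ha : n ≡ c [MOD q]
    · by_cases hb : 2 ∣ n
      · rw [if_pos ⟨ha, hb⟩, if_pos ha, Jfun_eq hn0 hb]
      · rw [if_neg (fun h => hb h.2), if_pos ha]
        unfold Jfun
        rw [if_neg hb, zero_mul]
    · rw [if_neg (fun h => ha h.1), if_neg ha, zero_mul]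
  rw [h1, sum_divisors_swap (fun n => if n ≡ c [MOD q] ∧ 2 ∣ n then twinC * n else 0) hF,
    Finset.mul_sum]
  refine Finset.sum_congr rfl fun d hd => ?_
  by_cases h2 : 2 ∣ d
  · rw [hF_even h2]
    ring
  · rw [mul_left_comm]
    congr 1
    rw [Finset.mul_sum, ← Finset.sum_filter, Finset.filter_filter]
    have hcop : Nat.Coprime 2 d := (Nat.Prime.coprime_iff_not_dvd Nat.prime_two).2 h2
    have hiff : ∀ n, 2 * d ∣ n ↔ 2 ∣ n ∧ d ∣ n := fun n =>
      ⟨fun h => ⟨(dvd_mul_right _ _).trans h, (dvd_mul_left _ _).trans h⟩,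
        fun h => hcop.mul_dvd_of_dvd_of_dvd h.1 h.2⟩
    refine Finset.sum_subset ?_ ?_
    · intro n hn
      simp only [Finset.mem_filter, Finset.mem_Ioc, Finset.mem_Iic, hiff] at hn ⊢
      tauto
    · intro n hn hn'
      simp only [Finset.mem_filter, Finset.mem_Ioc, Finset.mem_Iic, hiff] at hn hn'
      have : n = 0 := by
        by_contra h
        exact hn' ⟨⟨by omega, hn.1⟩, hn.2.2.2, hn.2.1, hn.2.2.1⟩
      subst this
      simp

theorem term_bound (c q d : ℕ) (hq : 0 < q) (hd : 0 < d) (hg : Nat.gcd 2 q ∣ c) (x : ℝ)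
    (hx : 0 ≤ x) :
    |hF d * (∑ n ∈ (Finset.Iic ⌊x⌋₊).filter (fun n => n ≡ c [MOD q] ∧ 2 * d ∣ n), (n : ℝ))
      - (Nat.gcd 2 q : ℕ) / (2 * q) * gG q c d * (x ^ 2 / 2)| ≤ 3 * x * hF d := by
  by_cases h2 : 2 ∣ d
  · have : gG q c d = 0 := by
      unfold gG
      rw [hF_even h2]
      simp
    rw [hF_even h2, this]
    simp
  have hcop : Nat.Coprime 2 d := (Nat.Prime.coprime_iff_not_dvd Nat.prime_two).2 h2
  have hgcd : Nat.gcd (2 * d) q = Nat.gcd 2 q * Nat.gcd d q := by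
    rw [Nat.gcd_comm, hcop.gcd_mul, Nat.gcd_comm q, Nat.gcd_comm q]
  have hcop' : Nat.Coprime (Nat.gcd 2 q) (Nat.gcd d q) :=
    (hcop.coprime_dvd_left (Nat.gcd_dvd_left _ _)).coprime_dvd_right (Nat.gcd_dvd_left _ _)
  have hh := hF_nonneg d
  by_cases hdc : Nat.gcd d q ∣ c
  · have hgc : Nat.gcd (2 * d) q ∣ c := by
      rw [hgcd]
      exact hcop'.mul_dvd_of_dvd_of_dvd hg hdc
    have hb := ap_sum c q (2 * d) hq (by omega) hgc x hx
    have hlcm : (Nat.gcd 2 q : ℝ) * (Nat.gcd d q : ℝ) * (Nat.lcm (2 * d) q : ℝ) = 2 * d * q := by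
      have := Nat.gcd_mul_lcm (2 * d) q
      rw [hgcd] at this
      exact_mod_cast this
    have hl0 : (Nat.lcm (2 * d) q : ℝ) ≠ 0 := by
      exact_mod_cast (Nat.lcm_pos (by omega) hq).ne'
    have hd0 : (d : ℝ) ≠ 0 := by exact_mod_cast hd.ne'
    have hq0 : (q : ℝ) ≠ 0 := by exact_mod_cast hq.ne'
    have e : (Nat.gcd 2 q : ℕ) / (2 * q) * gG q c d * (x ^ 2 / 2)
        = hF d * (x ^ 2 / (2 * (Nat.lcm (2 * d) q : ℕ))) := by
      unfold gG
      rw [if_pos hdc]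
      field_simp
      linear_combination (hF d * x ^ 2) * hlcm
    rw [e, ← mul_sub, abs_mul, abs_of_nonneg hh, mul_comm (3 * x)]
    exact mul_le_mul_of_nonneg_left hb hh
  · have hgc : ¬ Nat.gcd (2 * d) q ∣ c := fun h =>
      hdc ((by rw [hgcd]; exact dvd_mul_left _ _ : Nat.gcd d q ∣ Nat.gcd (2 * d) q).trans h)
    rw [ap_sum_empty c q (2 * d) _ hgc]
    unfold gG
    rw [if_neg hdc]
    simp only [mul_zero, zero_mul, sub_zero, abs_zero]
    positivity

theorem kG_le (c q d : ℕ) (hq : 0 < q) :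
    (Nat.gcd 2 q : ℕ) / (2 * q) * gG q c d ≤ hF d / d := by
  have h1 := gG_le q c hq d
  have hq0 : (0 : ℝ) < q := by exact_mod_cast hq
  have hg : ((Nat.gcd 2 q : ℕ) : ℝ) ≤ 2 := by
    exact_mod_cast Nat.gcd_le_left q (by norm_num : 0 < 2)
  have hh : 0 ≤ hF d / d := div_nonneg (hF_nonneg d) (Nat.cast_nonneg _)
  calc ((Nat.gcd 2 q : ℕ) : ℝ) / (2 * q) * gG q c d
      ≤ 2 / (2 * q) * (hF d / d * q) := by
        have := gG_nonneg q c d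
        gcongr
    _ = hF d / d := by field_simp

theorem tail_bound (c q N : ℕ) (hq : 0 < q) :
    |(Nat.gcd 2 q : ℕ) / (2 * q) * (∑ d ∈ Finset.Ioc 0 N, gG q c d)
      - (Nat.gcd 2 q : ℕ) / (2 * q) * ∑' d, gG q c d| ≤ kK * (2 / ((N : ℝ) + 1)) := by
  set κ : ℝ := (Nat.gcd 2 q : ℕ) / (2 * q) with hκ
  have hκ0 : 0 ≤ κ := by positivity
  have hs := gG_summable q c hq
  have hr : ∑ d ∈ Finset.range (N + 1), gG q c d = ∑ d ∈ Finset.Ioc 0 N, gG q c d := by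
    symm
    refine Finset.sum_subset ?_ ?_
    · intro d hd
      simp only [Finset.mem_Ioc, Finset.mem_range] at hd ⊢
      omega
    · intro d hd hd'
      simp only [Finset.mem_Ioc, Finset.mem_range] at hd hd'
      have : d = 0 := by omega
      subst this
      simp [gG, hF, sqfF_zero]
  have hsplit := hs.sum_add_tsum_nat_add (N + 1)
  rw [hr] at hsplit
  rw [← hsplit, mul_add, sub_add_cancel_left, abs_neg, ← tsum_mul_left, abs_of_nonneg
    (tsum_nonneg fun i => mul_nonneg hκ0 (gG_nonneg _ _ _))]
  refine Real.tsum_le_of_sum_range_le (fun i => mul_nonneg hκ0 (gG_nonneg _ _ _)) fun n => ?_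
  calc ∑ i ∈ Finset.range n, κ * gG q c (i + (N + 1))
      ≤ ∑ i ∈ Finset.range n, hF (i + (N + 1)) / ((i + (N + 1) : ℕ) : ℝ) :=
        Finset.sum_le_sum fun i _ => kG_le c q _ hq
    _ = ∑ d ∈ Finset.Ioc N (N + n), hF d / d := by
        refine Finset.sum_bij (fun i _ => i + (N + 1)) ?_ ?_ ?_ ?_
        · intro i hi
          simp only [Finset.mem_Ioc, Finset.mem_range] at hi ⊢
          omega
        · intro i _ j _ h
          omega
        · intro d hd
          simp only [Finset.mem_Ioc] at hd
          exact ⟨d - (N + 1), Finset.mem_range.2 (by omega), by omega⟩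
        · intro i _
          rfl
    _ ≤ _ := hF_sum_tail _ _

/-- For positive integers `c, q` and `x ≥ 2`,
`∑_{n ≤ x, n ≡ c (mod q)} J(n) = (𝔖_q(c)/2)x² + O(x log x)` with an absolute implied
constant. -/
theorem statement_18 :
    ∃ C : ℝ, 0 < C ∧ ∀ c q : ℕ, 0 < c → 0 < q → ∀ x : ℝ, 2 ≤ x →
      |(∑ n ∈ (Finset.Iic ⌊x⌋₊).filter (fun n => n ≡ c [MOD q]), Jfun n)
          - singSeries q c / 2 * x ^ 2|
        ≤ C * x * Real.log x := by
  have hK := kK_nonneg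
  refine ⟨11 * (|twinC| * kK) + 1, by positivity, ?_⟩
  intro c q hc hq x hx
  have hlog : 1 / 2 ≤ Real.log x := by
    have h1 := Real.log_two_gt_d9
    have h2 := Real.log_le_log (by norm_num) hx
    linarith
  by_cases hg : Nat.gcd 2 q ∣ c
  · set N := ⌊x⌋₊ with hN
    set κ : ℝ := (Nat.gcd 2 q : ℕ) / (2 * q) with hκ
    set A : ℕ → ℝ := fun d =>
      ∑ n ∈ (Finset.Iic N).filter (fun n => n ≡ c [MOD q] ∧ 2 * d ∣ n), (n : ℝ) with hA
    have hN1 : x < (N : ℝ) + 1 := Nat.lt_floor_add_one x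
    have hN2 : (N : ℝ) ≤ x := Nat.floor_le (by linarith)
    have hN0 : (0 : ℝ) < N := by
      have : 0 < ⌊x⌋₊ := Nat.floor_pos.2 (by linarith)
      exact_mod_cast this
    have hlogN : Real.log N ≤ Real.log x := Real.log_le_log hN0 hN2
    have b1 : |∑ d ∈ Finset.Ioc 0 N, hF d * A d
        - κ * (∑ d ∈ Finset.Ioc 0 N, gG q c d) * (x ^ 2 / 2)|
        ≤ 3 * x * (kK * (1 + Real.log x)) := by
      rw [Finset.mul_sum, Finset.sum_mul, ← Finset.sum_sub_distrib]
      refine (Finset.abs_sum_le_sum_abs _ _).trans ?_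
      refine (Finset.sum_le_sum fun d hd => term_bound c q d hq (Finset.mem_Ioc.1 hd).1 hg x
        (by linarith)).trans ?_
      rw [← Finset.mul_sum]
      refine mul_le_mul_of_nonneg_left ?_ (by linarith)
      refine (hF_sum_head N).trans ?_
      gcongr
    have b2 := tail_bound c q N hq
    rw [← hκ] at b2
    have b3 : kK * (2 / ((N : ℝ) + 1)) ≤ kK * (2 / x) := by gcongr
    rw [sum_J_eq, main_const q c hq hg]
    have e : twinC * ∑ d ∈ Finset.Ioc 0 N, hF d * A d
        - twinC * κ * (∑' d, gG q c d) / 2 * x ^ 2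
        = twinC * ((∑ d ∈ Finset.Ioc 0 N, hF d * A d
          - κ * (∑ d ∈ Finset.Ioc 0 N, gG q c d) * (x ^ 2 / 2))
          + (κ * (∑ d ∈ Finset.Ioc 0 N, gG q c d) - κ * ∑' d, gG q c d) * (x ^ 2 / 2)) := by
      ring
    rw [e, abs_mul]
    have b4 : |(κ * (∑ d ∈ Finset.Ioc 0 N, gG q c d) - κ * ∑' d, gG q c d) * (x ^ 2 / 2)|
        ≤ kK * x := by
      rw [abs_mul, abs_of_nonneg (by positivity : (0 : ℝ) ≤ x ^ 2 / 2)]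
      calc _ ≤ kK * (2 / x) * (x ^ 2 / 2) :=
            mul_le_mul_of_nonneg_right (b2.trans b3) (by positivity)
        _ = kK * x := by
          have : x ≠ 0 := by linarith
          field_simp
    calc _ ≤ |twinC| * (3 * x * (kK * (1 + Real.log x)) + kK * x) := by
          refine mul_le_mul_of_nonneg_left ?_ (abs_nonneg _)
          exact (abs_add_le _ _).trans (add_le_add b1 b4)
      _ = |twinC| * kK * x * (4 + 3 * Real.log x) := by ring
      _ ≤ |twinC| * kK * x * (11 * Real.log x) := by
          refine mul_le_mul_of_nonneg_left (by linarith) (by positivity)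
      _ ≤ _ := by
          have : 0 ≤ x * Real.log x := by nlinarith
          nlinarith
  · have h2q : 2 ∣ q := by
      by_contra h
      rw [(Nat.coprime_iff_gcd_eq_one.1 ((Nat.Prime.coprime_iff_not_dvd Nat.prime_two).2 h))] at hg
      exact hg (one_dvd _)
    have h2c : ¬ 2 ∣ c := by rwa [Nat.gcd_eq_left h2q] at hg
    have hz : ∑ n ∈ (Finset.Iic ⌊x⌋₊).filter (fun n => n ≡ c [MOD q]), Jfun n = 0 := by
      refine Finset.sum_eq_zero fun n hn => ?_
      have h := (Finset.mem_filter.1 hn).2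
      unfold Jfun
      rw [if_neg]
      intro h2
      exact h2c (((h.of_dvd h2q).dvd_iff dvd_rfl).1 h2)
    have hs : singSeries q c = 0 := by
      unfold singSeries
      rw [Finset.prod_eq_zero (i := 2), mul_zero]
      · exact Finset.mem_filter.2 ⟨Nat.mem_primeFactors.2 ⟨Nat.prime_two, h2q, hq.ne'⟩, h2c⟩
      · norm_num
    rw [hz, hs]
    simp only [zero_div, zero_mul, sub_zero, abs_zero]
    positivity
end
end
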